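/- arXiv:1001.0811 — 2 statements merged into one kernel-verified Lean document; each statement's English description precedes it below -/
import Mathlib

section
/- For every prime p and every integer r ≥ 1, there exist partitions λ and μ of some common integer n such that the nilpotent similarity classes N(λ) and N(μ) commute over the field F_{p^a} if and only if a > r. -/
open Polynomial Matrix

/-- Two square matrices over a commutative ring are *similar* if they are
conjugate by an invertible matrix. -/
def SimilarMat {m : Type*} [Fintype m] [DecidableEq m] {K : Type*} [CommRing K]
    (A B : Matrix m m K) : Prop :=
  ∃ P : (Matrix m m K)ˣ, B = (↑P : Matrix m m K) * A * (↑P⁻¹ : Matrix m m K)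

/-- The nilpotent Jordan block of size `p` (eigenvalue `0`). -/
def jordanBlock (K : Type*) [Zero K] [One K] (p : ℕ) : Matrix (Fin p) (Fin p) K :=
  Matrix.of fun i j => if (i : ℕ) + 1 = (j : ℕ) then 1 else 0

/-- `M` is a nilpotent matrix whose Jordan block sizes are the parts of the
partition `mu`; that is, `M` is similar to the direct sum of the nilpotent
Jordan blocks whose sizes are the parts of `mu`. -/
def HasJordanPartition {K : Type*} [Field K] {n : ℕ}
    (M : Matrix (Fin n) (Fin n) K) (mu : Nat.Partition n) : Prop :=
  ∃ L : List ℕ, (↑L : Multiset ℕ) = mu.parts ∧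
    ∃ e : ((i : Fin L.length) × Fin (L.get i)) ≃ Fin n,
      SimilarMat (Matrix.reindex e e (Matrix.blockDiagonal' fun i => jordanBlock K (L.get i))) M

theorem Nat.gcd_lcm_dvd_lcm_gcd {N a b : ℕ} (ha : a ≠ 0) (hb : b ≠ 0) :
    N.gcd (a.lcm b) ∣ (N.gcd a).lcm (N.gcd b) := by
  rw [Nat.dvd_iff_prime_pow_dvd_dvd]
  intro l k hl h
  have hN := h.trans (Nat.gcd_dvd_left _ _)
  have hL := h.trans (Nat.gcd_dvd_right _ _)
  rw [hl.pow_dvd_iff_le_factorization (Nat.lcm_ne_zero ha hb), Nat.factorization_lcm ha hb,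
    Finsupp.sup_apply, le_sup_iff] at hL
  rcases hL with hL | hL
  · rw [← hl.pow_dvd_iff_le_factorization ha] at hL
    exact (Nat.dvd_gcd hN hL).trans (Nat.dvd_lcm_left _ _)
  · rw [← hl.pow_dvd_iff_le_factorization hb] at hL
    exact (Nat.dvd_gcd hN hL).trans (Nat.dvd_lcm_right _ _)

theorem Finset.gcd_lcm_dvd {ι : Type*} (S : Finset ι) (f : ι → ℕ) (N M : ℕ)
    (hf : ∀ i ∈ S, f i ≠ 0) (h : ∀ i ∈ S, N.gcd (f i) ∣ M) :
    N.gcd (S.lcm f) ∣ M := by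
  classical
  induction S using Finset.induction_on with
  | empty => simp
  | insert i S hi ih =>
    rw [Finset.lcm_insert]
    have h0 : S.lcm f ≠ 0 := by
      rw [Ne, Finset.lcm_eq_zero_iff]
      rintro ⟨j, hj, hj'⟩
      exact hf j (Finset.mem_insert_of_mem hj) hj'
    refine (Nat.gcd_lcm_dvd_lcm_gcd (hf i (Finset.mem_insert_self _ _)) h0).trans ?_
    exact Nat.lcm_dvd (h i (Finset.mem_insert_self _ _))
      (ih (fun j hj => hf j (Finset.mem_insert_of_mem hj))
        fun j hj => h j (Finset.mem_insert_of_mem hj))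

/-- `p` times the least common multiple of the numbers `p ^ (2 i) - 1` with `1 ≤ i ≤ r`. -/
def lcmExponent (p r : ℕ) : ℕ := p * (Finset.Icc 1 r).lcm fun i => p ^ (2 * i) - 1

theorem pow_two_mul_sub_one_ne_zero {p i : ℕ} (hp : p.Prime) (hi : 1 ≤ i) :
    p ^ (2 * i) - 1 ≠ 0 := by
  have := Nat.one_lt_pow (n := 2 * i) (by omega) hp.one_lt
  omega

theorem lcmExponent_ne_zero {p : ℕ} (r : ℕ) (hp : p.Prime) : lcmExponent p r ≠ 0 := by
  refine mul_ne_zero hp.ne_zero ?_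
  rw [Ne, Finset.lcm_eq_zero_iff]
  rintro ⟨j, hj, hj'⟩
  exact pow_two_mul_sub_one_ne_zero hp (Finset.mem_Icc.1 hj).1 hj'

theorem three_le_lcmExponent {p r : ℕ} (hp : p.Prime) (hr : 1 ≤ r) : 3 ≤ lcmExponent p r := by
  have h : p ^ (2 * 1) - 1 ∣ lcmExponent p r :=
    (Finset.dvd_lcm (f := fun i => p ^ (2 * i) - 1) (Finset.mem_Icc.2 ⟨le_rfl, hr⟩)).mul_left p
  have h1 := Nat.le_of_dvd (Nat.pos_of_ne_zero (lcmExponent_ne_zero r hp)) h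
  have h2 := Nat.pow_le_pow_left hp.two_le (2 * 1)
  omega

theorem pow_two_mul_sub_one_dvd_lcmExponent {p r a : ℕ} (ha : 1 ≤ a) (har : a ≤ r) :
    p ^ (2 * a) - 1 ∣ lcmExponent p r :=
  (Finset.dvd_lcm (f := fun i => p ^ (2 * i) - 1) (Finset.mem_Icc.2 ⟨ha, har⟩)).mul_left p

theorem gcd_sub_one_add_one_dvd_two {q : ℕ} (hq : 1 ≤ q) : (q - 1).gcd (q + 1) ∣ 2 := by
  have h := Nat.dvd_sub (Nat.gcd_dvd_right (q - 1) (q + 1)) (Nat.gcd_dvd_left (q - 1) (q + 1))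
  rwa [show q + 1 - (q - 1) = 2 by omega] at h

/-- `Φ_{2a}(p)` exceeds the greatest common divisor of `p ^ a - 1` and `p ^ a + 1`. -/
theorem gcd_lt_natAbs_cyclotomic_eval {p a : ℕ} (hp : p.Prime) (ha : 1 ≤ a) :
    (p ^ a - 1).gcd (p ^ a + 1) < ((cyclotomic (2 * a) ℤ).eval (p : ℤ)).natAbs := by
  have hpa : 1 ≤ p ^ a := Nat.one_le_pow _ _ hp.pos
  have hc := sub_one_lt_natAbs_cyclotomic_eval (n := 2 * a) (q := p) (by omega) hp.ne_one
  have h2 := gcd_sub_one_add_one_dvd_two hpa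
  rcases hp.eq_two_or_odd' with rfl | hodd
  · have hodd : Odd (2 ^ a + 1) := (Nat.even_pow.2 ⟨even_two, by omega⟩).add_one
    have : ((2 ^ a - 1).gcd (2 ^ a + 1)) = 1 := by
      rcases (Nat.dvd_prime Nat.prime_two).1 h2 with h | h
      · exact h
      · exact absurd (h ▸ Nat.gcd_dvd_right (2 ^ a - 1) (2 ^ a + 1))
          (by rwa [← even_iff_two_dvd, Nat.not_even_iff_odd])
    omega
  · have := Nat.le_of_dvd two_pos h2
    have h3 : p ≠ 2 := by rintro rfl; exact absurd hodd (by decide)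
    have := hp.two_le
    omega

theorem not_dvd_lcmExponent {p r a : ℕ} (hp : p.Prime) (hr : r < a) :
    ¬ (p ^ a - 1 ∣ lcmExponent p r ∧ p ^ a + 1 ∣ lcmExponent p r) := by
  rintro ⟨h1, h2⟩
  have ha : 1 ≤ a := by omega
  have hpa : 1 < p ^ a := Nat.one_lt_pow (by omega) hp.one_lt
  set g := (p ^ a - 1).gcd (p ^ a + 1) with hg
  set c := ((cyclotomic (2 * a) ℤ).eval (p : ℤ)).natAbs with hc
  set N := p ^ (2 * a) - 1 with hN
  have hN0 : N ≠ 0 := pow_two_mul_sub_one_ne_zero hp ha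
  have hmul : (p ^ a - 1) * (p ^ a + 1) = N := by
    rw [hN, mul_comm 2 a, pow_mul, mul_comm, ← Nat.sq_sub_sq, one_pow]
  have hcop : N.Coprime p := by
    rw [Nat.coprime_comm, hp.coprime_iff_not_dvd]
    intro h
    have h' : p ∣ p ^ (2 * a) := dvd_pow_self p (by omega)
    have := (Nat.dvd_sub_iff_right (Nat.one_le_pow _ _ hp.pos) h').1 h
    exact hp.one_lt.ne' (Nat.dvd_one.1 this)
  have hdvd : N ∣ g * (Finset.Icc 1 r).lcm fun i => p ^ (2 * i) - 1 := by
    refine hcop.dvd_of_dvd_mul_left (m := p) ?_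
    rw [mul_left_comm, ← hmul, ← Nat.gcd_mul_lcm, ← hg]
    exact Nat.mul_dvd_mul_left g (Nat.lcm_dvd h1 h2)
  have key : ∀ d, d ∣ 2 * a → d < 2 * a → (p ^ d - 1) * c ∣ N := by
    intro d hd hlt
    have h := map_dvd (evalRingHom (p : ℤ))
      (X_pow_sub_one_mul_cyclotomic_dvd_X_pow_sub_one_of_dvd ℤ
        (Nat.mem_properDivisors.2 ⟨hd, hlt⟩))
    have h' := Int.natAbs_dvd_natAbs.2 h
    simp only [coe_evalRingHom, eval_mul, eval_sub, eval_pow, eval_X, eval_one,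
      Int.natAbs_mul] at h'
    have e : ∀ k, ((p : ℤ) ^ k - 1).natAbs = p ^ k - 1 := by
      intro k
      have : 1 ≤ p ^ k := Nat.one_le_pow _ _ hp.pos
      have : (p : ℤ) ^ k - 1 = ((p ^ k - 1 : ℕ) : ℤ) := by push_cast [this]; rfl
      rw [this, Int.natAbs_natCast]
    rwa [e, e] at h'
  obtain ⟨M, hM⟩ : c ∣ N := (Dvd.intro_left _ rfl).trans (key 1 (one_dvd _) (by omega))
  have hc0 : c ≠ 0 := by rintro h; rw [h, zero_mul] at hM; exact hN0 hM
  have hM0 : M ≠ 0 := by rintro h; rw [h, mul_zero] at hM; exact hN0 hM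
  have hgcd : N.gcd ((Finset.Icc 1 r).lcm fun i => p ^ (2 * i) - 1) ∣ M := by
    refine Finset.gcd_lcm_dvd _ _ _ _
      (fun i hi => pow_two_mul_sub_one_ne_zero hp (Finset.mem_Icc.1 hi).1) fun i hi => ?_
    rw [Finset.mem_Icc] at hi
    rw [hN, Nat.pow_sub_one_gcd_pow_sub_one]
    have hlt : (2 * a).gcd (2 * i) < 2 * a :=
      (Nat.le_of_dvd (by omega) (Nat.gcd_dvd_right _ _)).trans_lt (by omega)
    have := key _ (Nat.gcd_dvd_left (2 * a) (2 * i)) hlt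
    rw [hM, mul_comm c M] at this
    exact Nat.dvd_of_mul_dvd_mul_right (Nat.pos_of_ne_zero hc0) this
  have hfin : N ∣ g * M := by
    have h3 : N ∣ (g * N).gcd (g * (Finset.Icc 1 r).lcm fun i => p ^ (2 * i) - 1) :=
      Nat.dvd_gcd (dvd_mul_left _ _) hdvd
    rw [Nat.gcd_mul_left] at h3
    exact h3.trans (Nat.mul_dvd_mul_left g hgcd)
  rw [hM] at hfin
  have hcg := Nat.dvd_of_mul_dvd_mul_right (Nat.pos_of_ne_zero hM0) hfin
  have hg0 : 0 < g := Nat.gcd_pos_of_pos_left _ (by omega)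
  exact absurd (Nat.le_of_dvd hg0 hcg) (not_le.2 (gcd_lt_natAbs_cyclotomic_eval hp ha))

/-- The Lucas sequence `U_k(s, d)`: `U_0 = 0`, `U_1 = 1`, `U_{k+2} = s U_{k+1} - d U_k`. -/
def lucasU {R : Type*} [CommRing R] (s d : R) : ℕ → R
  | 0 => 0
  | 1 => 1
  | k + 2 => s * lucasU s d (k + 1) - d * lucasU s d k

theorem lucasU_succ_succ {R : Type*} [CommRing R] (s d : R) (k : ℕ) :
    lucasU s d (k + 2) = s * lucasU s d (k + 1) - d * lucasU s d k := rfl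

theorem map_lucasU {R S : Type*} [CommRing R] [CommRing S] (f : R →+* S) (s d : R) (k : ℕ) :
    f (lucasU s d k) = lucasU (f s) (f d) k := by
  induction k using Nat.twoStepInduction with
  | zero => simp [lucasU]
  | one => simp [lucasU]
  | more k h0 h1 => simp [lucasU_succ_succ, h0, h1]

theorem lucasU_mul_sub {R : Type*} [CommRing R] (α β : R) (k : ℕ) :
    lucasU (α + β) (α * β) k * (α - β) = α ^ k - β ^ k := by
  induction k using Nat.twoStepInduction with
  | zero => simp [lucasU]
  | one => simp [lucasU]
  | more k h0 h1 =>
    rw [lucasU_succ_succ, sub_mul, mul_assoc, mul_assoc (α * β), h0, h1]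
    ring

theorem lucasU_add_self {R : Type*} [CommRing R] (α : R) (k : ℕ) :
    lucasU (α + α) (α * α) (k + 1) = (k + 1) * α ^ k := by
  induction k using Nat.twoStepInduction with
  | zero => simp [lucasU]
  | one => simp [lucasU]; ring
  | more k h0 h1 =>
    rw [lucasU_succ_succ, h0, h1]
    push_cast
    ring

theorem lucasU_mul_sq {R : Type*} [CommRing R] (t s d : R) (k : ℕ) :
    lucasU (t * s) (t ^ 2 * d) (k + 1) = t ^ k * lucasU s d (k + 1) := by
  induction k using Nat.twoStepInduction with
  | zero => simp [lucasU]
  | one => simp [lucasU]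
  | more k h0 h1 =>
    rw [lucasU_succ_succ, h0, h1, lucasU_succ_succ s d (k + 1)]
    ring

/-- Cassini's identity for the Lucas sequence. -/
theorem lucasU_sq_sub {R : Type*} [CommRing R] (s d : R) (k : ℕ) :
    lucasU s d (k + 1) ^ 2 - lucasU s d k * lucasU s d (k + 2) = d ^ k := by
  induction k with
  | zero => simp [lucasU]
  | succ k ih =>
    have h1 := lucasU_succ_succ s d (k + 1)
    have h2 := lucasU_succ_succ s d k
    rw [pow_succ d, ← ih, h1, h2]
    ring

theorem pow_succ_eq_lucasU {R A : Type*} [CommRing R] [Ring A] [Algebra R A] {s d : R} {a : A}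
    (h : a ^ 2 = s • a - d • (1 : A)) (k : ℕ) :
    a ^ (k + 1) = lucasU s d (k + 1) • a - (d * lucasU s d k) • (1 : A) := by
  induction k with
  | zero => simp [lucasU]
  | succ k ih =>
    rw [pow_succ, ih, sub_mul, smul_mul_assoc, ← sq, h, smul_mul_assoc, one_mul,
      lucasU_succ_succ]
    module

theorem pow_card_sq_eq_self_of_root {K L : Type*} [Field K] [Fintype K] [Field L] [Algebra K L]
    {s d : K} {α β : L} (hs : α + β = algebraMap K L s) (hd : α * β = algebraMap K L d) :
    α ^ (Fintype.card K ^ 2) = α := by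
  have hq : ∀ x : K, algebraMap K L x ^ Fintype.card K = algebraMap K L x := fun x => by
    rw [← map_pow, FiniteField.pow_card]
  have root : ∀ γ : L, γ ^ 2 - algebraMap K L s * γ + algebraMap K L d = 0 → γ = α ∨ γ = β := by
    intro γ h
    rw [← hs, ← hd] at h
    have : (γ - α) * (γ - β) = 0 := by linear_combination h
    rcases mul_eq_zero.1 this with h | h
    · exact Or.inl (sub_eq_zero.1 h)
    · exact Or.inr (sub_eq_zero.1 h)
  have frob : ∀ γ : L, γ ^ 2 - algebraMap K L s * γ + algebraMap K L d = 0 →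
      γ ^ Fintype.card K = α ∨ γ ^ Fintype.card K = β := by
    intro γ h
    apply root
    have := congrArg (FiniteField.frobeniusAlgHom K L) h
    simpa only [map_add, map_sub, map_mul, map_pow, map_zero, AlgHom.commutes,
      FiniteField.coe_frobeniusAlgHom] using this
  have hα : α ^ 2 - algebraMap K L s * α + algebraMap K L d = 0 := by rw [← hs, ← hd]; ring
  have hβ : β ^ 2 - algebraMap K L s * β + algebraMap K L d = 0 := by rw [← hs, ← hd]; ring
  rw [sq, pow_mul]
  rcases frob α hα with h | h
  · rw [h, h]
  · rcases frob β hβ with h' | h'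
    · rw [h, h']
    · have : α = β := (FiniteField.frobeniusAlgHom K L).toRingHom.injective (by simp [h, h'])
      rw [h, h', this]

theorem lucasU_eq_zero_of_dvd {K : Type*} [Field K] [Fintype K] {n : ℕ} (hn : n ≠ 0)
    (hchar : (n : K) = 0) (hdvd : Fintype.card K ^ 2 - 1 ∣ n) (s : K) {d : K} (hd : d ≠ 0) :
    lucasU s d n = 0 := by
  let L := AlgebraicClosure K
  obtain ⟨α, hα⟩ : ∃ α : L, α ^ 2 - algebraMap K L s * α + algebraMap K L d = 0 := by
    have hdeg : (C 1 * X ^ 2 + C (-algebraMap K L s) * X + C (algebraMap K L d)).degree = 2 :=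
      degree_quadratic one_ne_zero
    obtain ⟨α, hα⟩ := IsAlgClosed.exists_root _ (hdeg.trans_ne two_ne_zero)
    refine ⟨α, ?_⟩
    simp only [IsRoot.def, eval_add, eval_mul, eval_C, eval_pow, eval_X] at hα
    linear_combination hα
  obtain ⟨β, hs⟩ : ∃ β : L, α + β = algebraMap K L s := ⟨_, add_sub_cancel _ _⟩
  have hd' : α * β = algebraMap K L d := by rw [← hs] at hα; linear_combination -hα
  have hαβ : α * β ≠ 0 := by rw [hd']; simpa using hd
  apply (algebraMap K L).injective
  rw [map_lucasU, map_zero, ← hs, ← hd']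
  have one : ∀ γ : L, γ ≠ 0 → γ ^ (Fintype.card K ^ 2) = γ → γ ^ n = 1 := by
    intro γ h0 h
    obtain ⟨m, rfl⟩ := hdvd
    have : γ ^ (Fintype.card K ^ 2 - 1) = 1 := by
      apply mul_right_cancel₀ h0
      rw [← pow_succ, Nat.sub_add_cancel (Nat.one_le_pow _ _ Fintype.card_pos), h, one_mul]
    rw [pow_mul, this, one_pow]
  have h1 := one α (left_ne_zero_of_mul hαβ) (pow_card_sq_eq_self_of_root hs hd')
  have h2 := one β (right_ne_zero_of_mul hαβ)
    (pow_card_sq_eq_self_of_root (by rw [add_comm, hs]) (by rw [mul_comm, hd']))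
  by_cases h : α = β
  · subst h
    obtain ⟨k, rfl⟩ := Nat.exists_eq_succ_of_ne_zero hn
    rw [lucasU_add_self]
    have := congrArg (algebraMap K L) hchar
    rw [map_natCast, map_zero] at this
    push_cast at this
    rw [this, zero_mul]
  · have := lucasU_mul_sub α β n
    rw [h1, h2, sub_self] at this
    exact (mul_eq_zero.1 this).resolve_right (sub_ne_zero.2 h)

theorem exists_algebraMap_eq_of_pow_card_eq {K L : Type*} [Field K] [Fintype K] [Field L]
    [Algebra K L] {x : L} (hx : x ^ Fintype.card K = x) : ∃ y : K, algebraMap K L y = x := by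
  have h : ∏ y : K, (X - C y) = X ^ Fintype.card K - X := by
    have hm : (X ^ Fintype.card K - X : K[X]).Monic :=
      monic_X_pow_sub (by rw [degree_X]; exact_mod_cast Fintype.one_lt_card)
    have := prod_multiset_X_sub_C_of_monic_of_roots_card_eq hm (by
      rw [FiniteField.roots_X_pow_card_sub_X,
        FiniteField.X_pow_card_sub_X_natDegree_eq K Fintype.one_lt_card]
      rfl)
    rwa [FiniteField.roots_X_pow_card_sub_X] at this
  have := congrArg (aeval x) h
  simp only [map_prod, map_sub, aeval_X, aeval_C, map_pow, hx, sub_self] at this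
  obtain ⟨y, -, hy⟩ := Finset.prod_eq_zero_iff.1 this
  exact ⟨y, (sub_eq_zero.1 hy).symm⟩

theorem exists_lucasU_ne_zero {K : Type*} [Field K] [Fintype K] {n : ℕ}
    (h : ¬ (Fintype.card K - 1 ∣ n ∧ Fintype.card K + 1 ∣ n)) :
    ∃ s d : K, d ≠ 0 ∧ lucasU s d n ≠ 0 := by
  by_cases h1 : Fintype.card K - 1 ∣ n
  · have h2 : ¬ Fintype.card K + 1 ∣ n := fun h2 => h ⟨h1, h2⟩
    let L := AlgebraicClosure K
    set q := Fintype.card K with hq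
    have hq1 : 1 < q := Fintype.one_lt_card
    have hq2 : 0 < q ^ 2 - 1 := by
      have := Nat.one_lt_pow two_ne_zero hq1
      omega
    have : NeZero (((q ^ 2 - 1 : ℕ)) : L) := by
      refine ⟨?_⟩
      rw [Nat.cast_sub (Nat.one_le_pow _ _ Fintype.card_pos), Nat.cast_pow,
        ← map_natCast (algebraMap K L), FiniteField.cast_card_eq_zero]
      simp
    obtain ⟨α, hα⟩ := HasEnoughRootsOfUnity.exists_primitiveRoot L (q ^ 2 - 1)
    have hα0 : α ≠ 0 := hα.ne_zero hq2.ne'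
    have hαq : (α ^ q) ^ q = α := by
      rw [← pow_mul, ← sq, ← Nat.sub_add_cancel (Nat.one_le_pow 2 q Fintype.card_pos), pow_succ,
        hα.pow_eq_one, one_mul]
    obtain ⟨s, hs⟩ := exists_algebraMap_eq_of_pow_card_eq (K := K) (x := α + α ^ q) (by
      have := map_add (FiniteField.frobeniusAlgHom K L) α (α ^ q)
      simp only [FiniteField.coe_frobeniusAlgHom] at this
      rw [this, ← hq, hαq, add_comm])
    obtain ⟨d, hd⟩ := exists_algebraMap_eq_of_pow_card_eq (K := K) (x := α * α ^ q) (by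
      rw [mul_pow, ← hq, hαq, mul_comm])
    refine ⟨s, d, ?_, ?_⟩
    · rintro rfl
      rw [map_zero] at hd
      exact mul_ne_zero hα0 (pow_ne_zero _ hα0) hd.symm
    · intro h0
      have := lucasU_mul_sub α (α ^ q) n
      rw [← hs, ← hd, ← map_lucasU, h0, map_zero, zero_mul] at this
      have h3 : α ^ ((q - 1) * n) = 1 := by
        apply mul_right_cancel₀ (pow_ne_zero n hα0)
        rw [one_mul, ← pow_add, sub_eq_zero.1 this.symm, ← pow_mul]
        congr 1
        nth_rewrite 2 [← Nat.sub_add_cancel hq1.le]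
        ring
      have h4 := hα.dvd_of_pow_eq_one _ h3
      have h5 : q ^ 2 - 1 = (q - 1) * (q + 1) := by
        rw [mul_comm, ← Nat.sq_sub_sq, one_pow]
      rw [h5] at h4
      exact h2 (Nat.dvd_of_mul_dvd_mul_left (by omega) h4)
  · rw [← FiniteField.forall_pow_eq_one_iff] at h1
    push Not at h1
    obtain ⟨c, hc⟩ := h1
    refine ⟨c + 1, c * 1, by simp, fun h0 => hc ?_⟩
    have := lucasU_mul_sub (c : K) 1 n
    rw [h0, zero_mul, one_pow] at this
    ext
    rw [Units.val_pow_eq_pow_val, Units.val_one, ← sub_eq_zero, ← this]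

/-- A basis whose `i`-th string is a Jordan chain of length `L_i` for the nilpotent map `f`. -/
def IsJordanBasis {K V : Type*} [Field K] [AddCommGroup V] [Module K V] (f : Module.End K V)
    (L : List ℕ) (c : Module.Basis ((i : Fin L.length) × Fin (L.get i)) K V) : Prop :=
  ∀ i (j : Fin (L.get i)), f (c ⟨i, j⟩) =
    if (j : ℕ) = 0 then 0 else c ⟨i, ⟨j - 1, (Nat.sub_le _ _).trans_lt j.2⟩⟩

theorem blockDiagonal'_jordanBlock_col {K : Type*} [Field K] (L : List ℕ) (i : Fin L.length)
    (j : Fin (L.get i)) (x : (i : Fin L.length) × Fin (L.get i)) :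
    Matrix.blockDiagonal' (fun i => jordanBlock K (L.get i)) x ⟨i, j⟩ =
      if (j : ℕ) = 0 then 0
      else if x = ⟨i, ⟨j - 1, (Nat.sub_le _ _).trans_lt j.2⟩⟩ then 1 else 0 := by
  obtain ⟨i', j'⟩ := x
  by_cases h : i' = i
  · subst h
    rw [Matrix.blockDiagonal'_apply_eq, jordanBlock, Matrix.of_apply]
    simp only [Sigma.mk.injEq, heq_eq_eq, true_and, Fin.ext_iff]
    split_ifs <;> first | rfl | omega
  · rw [Matrix.blockDiagonal'_apply_ne _ _ _ h]
    simp [h]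

theorem HasJordanPartition.exists_isJordanBasis {K : Type*} [Field K] {n : ℕ}
    {M : Matrix (Fin n) (Fin n) K} {mu : Nat.Partition n} (h : HasJordanPartition M mu) :
    ∃ L : List ℕ, (↑L : Multiset ℕ) = mu.parts ∧
      ∃ c : Module.Basis ((i : Fin L.length) × Fin (L.get i)) K (Fin n → K),
        IsJordanBasis (Matrix.toLin' M) L c := by
  obtain ⟨L, hL, e, P, rfl⟩ := h
  refine ⟨L, hL, ((Pi.basisFun K (Fin n)).map
    (Matrix.toLin'OfInv P.inv_mul P.mul_inv)).reindex e.symm, fun i j => ?_⟩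
  have hc : ∀ x, (((Pi.basisFun K (Fin n)).map
      (Matrix.toLin'OfInv P.inv_mul P.mul_inv)).reindex e.symm) x =
      (P : Matrix (Fin n) (Fin n) K) *ᵥ Pi.single (e x) 1 := fun x => by
    simp [Matrix.toLin'OfInv]
  rw [hc, Matrix.toLin'_apply, Matrix.mulVec_mulVec, mul_assoc, Units.inv_mul, mul_one,
    ← Matrix.mulVec_mulVec]
  have hB : (Matrix.reindex e e (Matrix.blockDiagonal' fun i => jordanBlock K (L.get i))) *ᵥ
      Pi.single (e ⟨i, j⟩) 1 =
      if (j : ℕ) = 0 then 0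
      else Pi.single (e ⟨i, ⟨j - 1, (Nat.sub_le _ _).trans_lt j.2⟩⟩) 1 := by
    ext a
    obtain ⟨x, rfl⟩ := e.surjective a
    rw [Matrix.mulVec_single_one, Matrix.col_apply, Matrix.reindex_apply, Matrix.submatrix_apply,
      Equiv.symm_apply_apply, Equiv.symm_apply_apply, blockDiagonal'_jordanBlock_col]
    split_ifs with h1 h2
    · rfl
    · rw [h2, Pi.single_eq_same]
    · rw [Pi.single_eq_of_ne (e.injective.ne h2)]
  rw [hB]
  split_ifs with h
  · rw [Matrix.mulVec_zero]
  · rw [hc]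

theorem IsJordanBasis.hasJordanPartition {K V : Type*} [Field K] [AddCommGroup V] [Module K V]
    {f : Module.End K V} {L : List ℕ}
    {c : Module.Basis ((i : Fin L.length) × Fin (L.get i)) K V} (hc : IsJordanBasis f L c) {n : ℕ}
    (b : Module.Basis (Fin n) K V) {mu : Nat.Partition n} (hL : (↑L : Multiset ℕ) = mu.parts) :
    HasJordanPartition (LinearMap.toMatrix b b f) mu := by
  let e := c.indexEquiv b
  let c' := c.reindex e
  refine ⟨L, hL, e, ⟨b.toMatrix c', c'.toMatrix b, b.toMatrix_mul_toMatrix_flip c',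
    c'.toMatrix_mul_toMatrix_flip b⟩, ?_⟩
  have hM : Matrix.reindex e e (Matrix.blockDiagonal' fun i => jordanBlock K (L.get i)) =
      LinearMap.toMatrix c' c' f := by
    ext x y
    obtain ⟨x, rfl⟩ := e.surjective x
    obtain ⟨⟨i, j⟩, rfl⟩ := e.surjective y
    rw [LinearMap.toMatrix_apply, Module.Basis.reindex_apply, Module.Basis.repr_reindex_apply,
      Equiv.symm_apply_apply, Equiv.symm_apply_apply, hc, Matrix.reindex_apply,
      Matrix.submatrix_apply, Equiv.symm_apply_apply, Equiv.symm_apply_apply,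
      blockDiagonal'_jordanBlock_col]
    split_ifs with h1 h2
    · simp
    · simp [h2]
    · rw [Module.Basis.repr_self, Finsupp.single_eq_of_ne h2]
  rw [hM]
  exact (basis_toMatrix_mul_linearMap_toMatrix_mul_basis_toMatrix b c' b c' f).symm

namespace IsJordanBasis

variable {K V : Type*} [Field K] [AddCommGroup V] [Module K V] {f : Module.End K V} {L : List ℕ}
  {c : Module.Basis ((i : Fin L.length) × Fin (L.get i)) K V}

theorem pow_apply (hc : IsJordanBasis f L c) (m : ℕ) (i : Fin L.length) (j : Fin (L.get i)) :
    (f ^ m) (c ⟨i, j⟩) =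
      if (j : ℕ) < m then 0 else c ⟨i, ⟨j - m, (Nat.sub_le _ _).trans_lt j.2⟩⟩ := by
  induction m with
  | zero => simp
  | succ m ih =>
    rw [pow_succ', Module.End.mul_apply, ih]
    by_cases h1 : (j : ℕ) < m
    · rw [if_pos h1, if_pos (h1.trans (Nat.lt_succ_self m)), map_zero]
    · rw [if_neg h1, hc]
      by_cases h2 : (j : ℕ) < m + 1
      · rw [if_pos h2, if_pos (by simp only []; omega)]
      · rw [if_neg h2, if_neg (by simp only []; omega)]
        rfl

theorem pow_eq_zero (hc : IsJordanBasis f L c) {m : ℕ} (hm : ∀ i, L.get i ≤ m) : f ^ m = 0 := by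
  refine c.ext fun ⟨i, j⟩ => ?_
  rw [hc.pow_apply, if_pos (j.2.trans_le (hm i)), LinearMap.zero_apply]

theorem pow_ne_zero (hc : IsJordanBasis f L c) {m : ℕ} {i : Fin L.length} (hm : m < L.get i) :
    f ^ m ≠ 0 := by
  intro h
  have := hc.pow_apply m i ⟨m, hm⟩
  rw [h, LinearMap.zero_apply, if_neg (lt_irrefl m)] at this
  exact c.ne_zero _ this.symm

theorem finrank_le (hc : IsJordanBasis f L c) :
    Module.finrank K V ≤ Module.finrank K (LinearMap.range f) + L.length := by
  have : Module.Finite K V := Module.Finite.of_basis c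
  let top : Fin L.length → V := fun i =>
    if h : 0 < L.get i then c ⟨i, ⟨L.get i - 1, Nat.sub_one_lt_of_lt h⟩⟩ else 0
  have hspan : LinearMap.range f ⊔ Submodule.span K (Set.range top) = ⊤ := by
    rw [eq_top_iff, ← c.span_eq, Submodule.span_le]
    rintro _ ⟨⟨i, j⟩, rfl⟩
    by_cases h : (j : ℕ) + 1 < L.get i
    · refine Submodule.mem_sup_left ⟨c ⟨i, ⟨j + 1, h⟩⟩, ?_⟩
      rw [hc, if_neg (by simp)]
      rfl
    · refine Submodule.mem_sup_right (Submodule.subset_span ⟨i, ?_⟩)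
      have hj := j.2
      simp only [top, dif_pos (Nat.zero_lt_of_lt hj)]
      congr 2
      ext
      simp only []
      omega
  calc Module.finrank K V
      = Module.finrank K ↥(LinearMap.range f ⊔ Submodule.span K (Set.range top)) := by
        rw [hspan, finrank_top]
    _ ≤ _ := Submodule.finrank_add_le_finrank_add_finrank _ _
    _ ≤ _ := by
        gcongr
        exact (finrank_range_le_card (R := K) top).trans_eq (Fintype.card_fin _)

theorem le_finrank (hc : IsJordanBasis f L c) (hL : ∀ i, 0 < L.get i) :
    Module.finrank K (LinearMap.range f) + L.length ≤ Module.finrank K V := by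
  have : Module.Finite K V := Module.Finite.of_basis c
  rw [← f.finrank_range_add_finrank_ker]
  gcongr
  let bot : Fin L.length → LinearMap.ker f := fun i =>
    ⟨c ⟨i, ⟨0, hL i⟩⟩, by rw [LinearMap.mem_ker, hc, if_pos rfl]⟩
  have hli : LinearIndependent K bot := by
    apply LinearIndependent.of_comp (LinearMap.ker f).subtype
    exact c.linearIndependent.comp (fun i => ⟨i, ⟨0, hL i⟩⟩) fun i i' h => congrArg Sigma.fst h
  simpa using hli.fintype_card_le_finrank

theorem repr_aeval (hc : IsJordanBasis f L c) (p : K[X]) (i i' : Fin L.length)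
    (hi : 0 < L.get i) (j : Fin (L.get i')) :
    c.repr (aeval f p (c ⟨i, ⟨L.get i - 1, Nat.sub_one_lt_of_lt hi⟩⟩)) ⟨i', j⟩ =
      if i = i' then p.coeff (L.get i' - 1 - j) else 0 := by
  induction p using Polynomial.induction_on' with
  | add p q hp hq =>
    rw [map_add, LinearMap.add_apply, map_add, Finsupp.add_apply, hp, hq, coeff_add]
    split_ifs <;> simp
  | monomial k a =>
    rw [aeval_monomial, Module.End.mul_apply, hc.pow_apply, Module.algebraMap_end_apply, map_smul,
      Finsupp.smul_apply, coeff_monomial]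
    by_cases h : i = i'
    · subst h
      have hj := j.2
      rw [if_pos rfl]
      by_cases h1 : L.get i - 1 < k
      · rw [if_pos h1, if_neg (by omega)]
        simp
      · rw [if_neg h1, Module.Basis.repr_self, Finsupp.single_apply]
        simp only [Sigma.mk.injEq, heq_eq_eq, true_and, Fin.ext_iff]
        by_cases h2 : k = L.get i - 1 - j
        · rw [if_pos h2, if_pos (by omega), smul_eq_mul, mul_one]
        · rw [if_neg h2, if_neg (by omega), smul_zero]
    · rw [if_neg h]
      split_ifs
      · simp
      · rw [Module.Basis.repr_self, Finsupp.single_eq_of_ne, smul_zero]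
        intro h'
        exact h (congrArg Sigma.fst h').symm

end IsJordanBasis

/-- A polynomial matrix all of whose entries are divisible by `X ^ k` is divisible by `X ^ k`. -/
theorem Matrix.exists_eq_X_pow_smul {K m : Type*} [Field K] {A : Matrix m m K[X]} {k : ℕ}
    (h : ∀ i j, X ^ k ∣ A i j) : ∃ B : Matrix m m K[X], A = (X ^ k : K[X]) • B := by
  choose B hB using h
  exact ⟨Matrix.of B, by ext1 i j; simp [hB i j]⟩

/-- A presentation of a `K[X]`-module (given by the endomorphism `f`) as `(K[X]/X^n)²`. -/
structure IsFreePresentation {K V : Type*} [Field K] [AddCommGroup V] [Module K V]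
    (f : Module.End K V) (n : ℕ) (φ : (Fin 2 → K[X]) →ₗ[K] V) : Prop where
  map_X_smul : ∀ u, φ ((X : K[X]) • u) = f (φ u)
  surjective : Function.Surjective φ
  map_eq_zero_iff : ∀ u, φ u = 0 ↔ ∀ i, X ^ n ∣ u i

namespace IsFreePresentation

variable {K V : Type*} [Field K] [AddCommGroup V] [Module K V] {f g : Module.End K V} {n : ℕ}
  {φ : (Fin 2 → K[X]) →ₗ[K] V}

theorem map_smul (h : IsFreePresentation f n φ) (p : K[X]) (u : Fin 2 → K[X]) :
    φ (p • u) = aeval f p (φ u) := by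
  induction p using Polynomial.induction_on with
  | C a =>
    rw [aeval_C, Module.algebraMap_end_apply, ← _root_.map_smul]
    congr 1
    ext1 i
    simp [smul_eq_C_mul]
  | add p q hp hq => rw [add_smul, map_add, hp, hq, map_add, LinearMap.add_apply]
  | monomial k a ih =>
    rw [pow_succ', mul_left_comm, mul_smul, h.map_X_smul, ih, map_mul (aeval f) X,
      aeval_X, Module.End.mul_apply]

theorem exists_matrix (h : IsFreePresentation f n φ) (hfg : Commute f g) :
    ∃ A : Matrix (Fin 2) (Fin 2) K[X], ∀ u, φ (A *ᵥ u) = g (φ u) := by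
  choose col hcol using fun i : Fin 2 => h.surjective (g (φ (Pi.single i 1)))
  refine ⟨Matrix.of fun i j => col j i, fun u => ?_⟩
  have hcomm : ∀ p : K[X], Commute (aeval f p) g := fun p => by
    induction p using Polynomial.induction_on' with
    | add p q hp hq => rw [map_add]; exact hp.add_left hq
    | monomial k a =>
      rw [aeval_monomial]
      exact (Algebra.commute_algebraMap_left a g).mul_left (hfg.pow_left k)
  have h1 : (Matrix.of fun i j => col j i) *ᵥ u = u 0 • col 0 + u 1 • col 1 := by
    ext1 i
    simp [Matrix.mulVec, dotProduct, Fin.sum_univ_two, mul_comm]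
  have h2 : u = u 0 • Pi.single 0 1 + u 1 • Pi.single 1 1 := by
    ext1 i
    fin_cases i <;> simp
  rw [h1, map_add, h.map_smul, h.map_smul, hcol, hcol]
  conv_rhs => rw [h2, map_add, h.map_smul, h.map_smul, map_add]
  congr 1 <;> exact LinearMap.congr_fun (hcomm _).eq _

theorem pow_eq_zero_iff (h : IsFreePresentation f n φ) {A : Matrix (Fin 2) (Fin 2) K[X]}
    (hA : ∀ u, φ (A *ᵥ u) = g (φ u)) (k : ℕ) : g ^ k = 0 ↔ ∀ i j, X ^ n ∣ (A ^ k) i j := by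
  have hpow : ∀ u, φ ((A ^ k) *ᵥ u) = (g ^ k) (φ u) := by
    induction k with
    | zero => simp
    | succ k ih =>
      intro u
      rw [pow_succ, ← Matrix.mulVec_mulVec, ih, hA, pow_succ, Module.End.mul_apply]
  constructor
  · intro hg i j
    have := (h.map_eq_zero_iff _).1 ((hpow (Pi.single j 1)).trans (by rw [hg]; rfl)) i
    rwa [Matrix.mulVec_single_one, Matrix.col_apply] at this
  · intro hd
    ext v
    obtain ⟨u, rfl⟩ := h.surjective v
    rw [← hpow, LinearMap.zero_apply, h.map_eq_zero_iff]
    intro i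
    rw [Matrix.mulVec, dotProduct]
    exact Finset.dvd_sum fun j _ => (hd i j).mul_right _

theorem X_dvd_of_range_le (h : IsFreePresentation f n φ) (hn : 1 ≤ n)
    {A : Matrix (Fin 2) (Fin 2) K[X]} (hA : ∀ u, φ (A *ᵥ u) = g (φ u))
    (hr : LinearMap.range g ≤ LinearMap.range f) (i j : Fin 2) : X ∣ A i j := by
  obtain ⟨v, hv⟩ := hr (LinearMap.mem_range_self g (φ (Pi.single j 1)))
  obtain ⟨w, rfl⟩ := h.surjective v
  rw [← hA, ← h.map_X_smul] at hv
  have hz : φ (A *ᵥ Pi.single j 1 - (X : K[X]) • w) = 0 := by rw [map_sub, hv, sub_self]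
  have hd := (h.map_eq_zero_iff _).1 hz i
  rw [Matrix.mulVec_single_one, Pi.sub_apply, Matrix.col_apply, Pi.smul_apply, smul_eq_mul] at hd
  exact (dvd_sub_left (dvd_mul_right X (w i))).1 ((dvd_pow_self X (by omega)).trans hd)

theorem X_dvd_trace_det (h : IsFreePresentation f n φ) (hn : 1 ≤ n)
    {A : Matrix (Fin 2) (Fin 2) K[X]} (hA : ∀ u, φ (A *ᵥ u) = g (φ u)) (hg : IsNilpotent g) :
    X ∣ A.trace ∧ X ∣ A.det := by
  obtain ⟨k, hk⟩ := hg
  have hd := (h.pow_eq_zero_iff hA k).1 hk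
  have hnil : IsNilpotent ((evalRingHom (0 : K)).mapMatrix A) := by
    refine ⟨k, ?_⟩
    rw [← map_pow]
    ext i j
    have := (dvd_pow_self X (by omega : n ≠ 0)).trans (hd i j)
    rw [X_dvd_iff, coeff_zero_eq_eval_zero] at this
    simpa using this
  constructor
  · have := (Matrix.isNilpotent_trace_of_isNilpotent hnil).eq_zero
    rw [X_dvd_iff, coeff_zero_eq_eval_zero]
    simpa [Matrix.trace] using this
  · have h1 : IsNilpotent ((evalRingHom (0 : K)).mapMatrix A).det := by
      obtain ⟨l, hl⟩ := hnil
      exact ⟨l, by rw [← Matrix.det_pow, hl, Matrix.det_zero]⟩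
    rw [← RingHom.map_det] at h1
    rw [X_dvd_iff, coeff_zero_eq_eval_zero]
    exact h1.eq_zero

/-- If the determinant has order one then `X` annihilates the cokernel. -/
theorem range_le_of_det (h : IsFreePresentation f n φ)
    {A : Matrix (Fin 2) (Fin 2) K[X]} (hA : ∀ u, φ (A *ᵥ u) = g (φ u)) {d : K[X]}
    (hd : A.det = X * d) (hd0 : ¬ X ∣ d) : LinearMap.range f ≤ LinearMap.range g := by
  rintro _ ⟨v, rfl⟩
  obtain ⟨u, rfl⟩ := h.surjective v
  have hcop : IsCoprime (X ^ n) d := ((prime_X.coprime_iff_not_dvd).2 hd0).pow_left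
  obtain ⟨a, b, hab⟩ := hcop
  refine ⟨φ (A.adjugate *ᵥ (b • u)), ?_⟩
  rw [← hA, Matrix.mulVec_mulVec, Matrix.mul_adjugate, ← h.map_X_smul, ← sub_eq_zero, ← map_sub,
    h.map_eq_zero_iff]
  intro i
  rw [hd, Matrix.smul_mulVec, Matrix.one_mulVec]
  refine ⟨- X * a * u i, ?_⟩
  simp only [Pi.sub_apply, Pi.smul_apply, smul_eq_mul]
  linear_combination X * u i * hab

theorem X_dvd_of_X_pow_three_dvd_det (h : IsFreePresentation f n φ) (hn : 3 ≤ n)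
    {A : Matrix (Fin 2) (Fin 2) K[X]} (hA : ∀ u, φ (A *ᵥ u) = g (φ u))
    (hr : LinearMap.range (f ^ 2) ≤ LinearMap.range g) (hd : X ^ 3 ∣ A.det) (i j : Fin 2) :
    X ∣ A i j := by
  have hadj : ∀ i j, X ∣ A.adjugate i j := by
    intro i j
    obtain ⟨v, hv⟩ := hr (LinearMap.mem_range_self (f ^ 2) (φ (Pi.single j 1)))
    obtain ⟨w, rfl⟩ := h.surjective v
    have hz : φ ((X : K[X]) • (X : K[X]) • Pi.single j 1 - A *ᵥ w) = 0 := by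
      rw [map_sub, hA, hv, h.map_X_smul, h.map_X_smul, sq, Module.End.mul_apply, sub_self]
    have hdiv := (h.map_eq_zero_iff _).1 hz
    have h1 : X ^ 3 ∣ (A.adjugate *ᵥ ((X : K[X]) • (X : K[X]) • Pi.single j 1 - A *ᵥ w)) i := by
      rw [Matrix.mulVec, dotProduct]
      exact Finset.dvd_sum fun k _ => ((pow_dvd_pow X hn).trans (hdiv k)).mul_left _
    rw [Matrix.mulVec_sub, Matrix.mulVec_mulVec, Matrix.adjugate_mul, Matrix.mulVec_smul,
      Matrix.mulVec_smul, Matrix.mulVec_single_one, Matrix.smul_mulVec, Matrix.one_mulVec] at h1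
    simp only [Pi.sub_apply, Pi.smul_apply, smul_eq_mul, Matrix.col_apply] at h1
    have h2 := (dvd_sub_left (hd.mul_right (w i))).1 h1
    rw [pow_succ', sq] at h2
    exact (mul_dvd_mul_iff_left X_ne_zero).1 ((mul_dvd_mul_iff_left X_ne_zero).1 h2)
  have h00 := hadj 0 0
  have h01 := hadj 0 1
  have h10 := hadj 1 0
  have h11 := hadj 1 1
  simp only [Matrix.adjugate_fin_two, Matrix.of_apply, Matrix.cons_val', Matrix.cons_val_zero,
    Matrix.cons_val_one, Matrix.cons_val_fin_one, dvd_neg] at h00 h01 h10 h11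
  fin_cases i <;> fin_cases j <;> assumption

/-- If all nondegenerate Lucas numbers `U_n` vanish over `K`, an endomorphism commuting with one
of type `(n, n)` and having a two-dimensional cokernel has vanishing `n`-th power. -/
theorem pow_eq_zero (h : IsFreePresentation f n φ) (hn : 3 ≤ n) (hfg : Commute f g)
    (hg : IsNilpotent g) (hle : LinearMap.range f ≤ LinearMap.range g →
      LinearMap.range g ≤ LinearMap.range f)
    (hr : LinearMap.range (f ^ 2) ≤ LinearMap.range g)
    (hU : ∀ s d : K, d ≠ 0 → lucasU s d n = 0) : g ^ n = 0 := by
  obtain ⟨A, hA⟩ := h.exists_matrix hfg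
  rw [h.pow_eq_zero_iff hA]
  by_cases hA0 : ∀ i j, X ∣ A i j
  · obtain ⟨B, rfl⟩ := Matrix.exists_eq_X_pow_smul (k := 1)
      (fun i j => by rw [pow_one]; exact hA0 i j)
    intro i j
    rw [_root_.smul_pow, pow_one, Matrix.smul_apply, smul_eq_mul]
    exact dvd_mul_right _ _
  · obtain ⟨⟨s, hs⟩, ⟨d, hd⟩⟩ := h.X_dvd_trace_det (by omega) hA hg
    have hXd : X ∣ d := by
      by_contra hXd
      exact hA0 (h.X_dvd_of_range_le (by omega) hA (hle (h.range_le_of_det hA hd hXd)))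
    obtain ⟨d, rfl⟩ := hXd
    have hXd : d.eval 0 ≠ 0 := by
      intro h0
      rw [← coeff_zero_eq_eval_zero, ← X_dvd_iff] at h0
      obtain ⟨e, rfl⟩ := h0
      exact hA0 (h.X_dvd_of_X_pow_three_dvd_det hn hA hr ⟨e, by rw [hd]; ring⟩)
    have hsq : A ^ 2 = (X * s) • A - (X ^ 2 * d) • (1 : Matrix (Fin 2) (Fin 2) K[X]) := by
      rw [← hs, show X ^ 2 * d = A.det by rw [hd]; ring, sq]
      ext1 i j
      fin_cases i <;> fin_cases j <;>
        simp [Matrix.mul_apply, Fin.sum_univ_two, Matrix.trace_fin_two, Matrix.det_fin_two] <;> ring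
    obtain ⟨k, rfl⟩ : ∃ k, n = k + 2 := ⟨n - 2, by omega⟩
    intro i j
    have hUX : X ∣ lucasU s d (k + 2) := by
      rw [X_dvd_iff, coeff_zero_eq_eval_zero, ← coe_evalRingHom, map_lucasU]
      exact hU _ _ hXd
    rw [pow_succ_eq_lucasU hsq (k + 1), lucasU_mul_sq X s d (k + 1), lucasU_mul_sq X s d k]
    rw [Matrix.sub_apply, Matrix.smul_apply, Matrix.smul_apply, smul_eq_mul, smul_eq_mul]
    obtain ⟨e, he⟩ := hUX
    rw [he]
    exact ⟨e * A i j - d * lucasU s d (k + 1) * (1 : Matrix (Fin 2) (Fin 2) K[X]) i j, by ring⟩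

end IsFreePresentation

theorem IsJordanBasis.exists_isFreePresentation {K V : Type*} [Field K] [AddCommGroup V]
    [Module K V] {f : Module.End K V} {L : List ℕ}
    {c : Module.Basis ((i : Fin L.length) × Fin (L.get i)) K V} (hc : IsJordanBasis f L c)
    {n : ℕ} (hn : 0 < n) (hlen : L.length = 2) (hL : ∀ i, L.get i = n) :
    ∃ φ, IsFreePresentation f n φ := by
  have hpos : ∀ i, 0 < L.get i := fun i => by rw [hL]; exact hn
  let top : Fin L.length → V := fun i => c ⟨i, ⟨L.get i - 1, Nat.sub_one_lt_of_lt (hpos i)⟩⟩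
  let φ : (Fin 2 → K[X]) →ₗ[K] V :=
    { toFun := fun u => ∑ i, aeval f (u (Fin.cast hlen i)) (top i)
      map_add' := fun u v => by simp [Finset.sum_add_distrib]
      map_smul' := fun a u => by simp [Finset.smul_sum] }
  have hφ : ∀ u, φ u = ∑ i, aeval f (u (Fin.cast hlen i)) (top i) := fun u => rfl
  have hrepr : ∀ u i (j : Fin (L.get i)),
      c.repr (φ u) ⟨i, j⟩ = (u (Fin.cast hlen i)).coeff (n - 1 - j) := fun u i j => by
    rw [hφ, map_sum, Finsupp.finsetSum_apply, Finset.sum_eq_single i]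
    · rw [hc.repr_aeval _ _ _ (hpos i), if_pos rfl, ← hL i]
    · intro i' _ hne
      rw [hc.repr_aeval _ _ _ (hpos i'), if_neg hne]
    · simp
  refine ⟨φ, fun u => ?_, fun v => ?_, fun u => ?_⟩
  · rw [hφ, hφ, map_sum]
    refine Finset.sum_congr rfl fun i _ => ?_
    rw [Pi.smul_apply, smul_eq_mul, map_mul, aeval_X, Module.End.mul_apply]
  · rw [← LinearMap.mem_range]
    suffices ⊤ ≤ LinearMap.range φ from this trivial
    rw [← c.span_eq, Submodule.span_le]
    rintro _ ⟨⟨i, j⟩, rfl⟩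
    refine ⟨Pi.single (Fin.cast hlen i) (X ^ (n - 1 - j)), c.repr.injective ?_⟩
    ext ⟨i', j'⟩
    have hj := j.2
    have hj' := j'.2
    have h1 := hL i
    have h2 := hL i'
    rw [hrepr, Module.Basis.repr_self, Finsupp.single_apply, Pi.single_apply]
    by_cases h : i' = i
    · subst h
      simp only [if_true, coeff_X_pow, Sigma.mk.injEq, heq_eq_eq, true_and, Fin.ext_iff]
      by_cases h3 : (j : ℕ) = j'
      · rw [if_pos h3, if_pos (by omega)]
      · rw [if_neg h3, if_neg (by omega)]
    · rw [if_neg (by simpa using h), if_neg (fun h' => h (congrArg Sigma.fst h').symm),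
        coeff_zero]
  · rw [← c.repr.map_eq_zero_iff, Finsupp.ext_iff]
    simp only [X_pow_dvd_iff]
    constructor
    · intro h i k hk
      have := h ⟨Fin.cast hlen.symm i, ⟨n - 1 - k, by rw [hL]; omega⟩⟩
      rw [hrepr] at this
      simpa [show n - 1 - (n - 1 - k) = k by omega] using this
    · rintro h ⟨i, j⟩
      rw [hrepr]
      exact h _ _ (by omega)

theorem LinearMap.range_pow_le_range_of_commute {K V : Type*} [Field K] [AddCommGroup V]
    [Module K V] [Module.Finite K V] {f g : Module.End K V} (hfg : Commute f g)
    (hf : IsNilpotent f) {m : ℕ}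
    (hm : Module.finrank K V ≤ Module.finrank K (LinearMap.range g) + m) :
    LinearMap.range (f ^ m) ≤ LinearMap.range g := by
  have hle : LinearMap.range g ≤ (LinearMap.range g).comap f := by
    rintro _ ⟨v, rfl⟩
    exact ⟨f v, (LinearMap.congr_fun hfg.eq v).symm⟩
  let f' : Module.End K (V ⧸ LinearMap.range g) := (LinearMap.range g).mapQ _ f hle
  have hpow : ∀ k v, (f' ^ k) ((LinearMap.range g).mkQ v) =
      (LinearMap.range g).mkQ ((f ^ k) v) := fun k v => by
    rw [← (LinearMap.range g).mapQ_pow hle]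
    rfl
  have hnil : IsNilpotent f' := by
    obtain ⟨k, hk⟩ := hf
    refine ⟨k, ?_⟩
    ext v
    have := hpow k v
    rw [hk, LinearMap.zero_apply, map_zero] at this
    simpa using this
  have h0 : f' ^ m = 0 := by
    have h1 := LinearMap.aeval_self_charpoly f'
    rw [hnil.charpoly_eq_X_pow_finrank, map_pow, aeval_X] at h1
    refine pow_eq_zero_of_le ?_ h1
    have := (LinearMap.range g).finrank_quotient_add_finrank
    omega
  rintro _ ⟨v, rfl⟩
  rw [← (LinearMap.range g).ker_mkQ, LinearMap.mem_ker, ← hpow, h0, LinearMap.zero_apply]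

/-- If all nondegenerate Lucas numbers `U_n` vanish over `K`, the nilpotent classes of types
`(n, n)` and `(n + 1, n - 1)` do not commute. -/
theorem not_commute_of_lucasU_eq_zero {K : Type*} [Field K] {n N : ℕ} (hn : 3 ≤ n)
    (hU : ∀ s d : K, d ≠ 0 → lucasU s d n = 0) {lam mu : Nat.Partition N}
    (hlam : lam.parts = {n, n}) (hmu : mu.parts = {n + 1, n - 1}) {A B : Matrix (Fin N) (Fin N) K}
    (hA : HasJordanPartition A lam) (hB : HasJordanPartition B mu) : ¬ Commute A B := by
  intro hAB
  obtain ⟨L, hL, c, hc⟩ := hA.exists_isJordanBasis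
  obtain ⟨M, hM, e, he⟩ := hB.exists_isJordanBasis
  rw [hlam] at hL
  rw [hmu] at hM
  have hLlen : L.length = 2 := by rw [← Multiset.coe_card, hL]; rfl
  have hMlen : M.length = 2 := by rw [← Multiset.coe_card, hM]; rfl
  have hLget : ∀ i, L.get i = n := fun i => by
    have : L.get i ∈ (L : Multiset ℕ) := List.get_mem L i
    rw [hL] at this
    simpa using this
  have hMget : ∀ i, M.get i = n + 1 ∨ M.get i = n - 1 := fun i => by
    have : M.get i ∈ (M : Multiset ℕ) := List.get_mem M i
    rw [hM] at this
    simpa using this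
  obtain ⟨i, hi⟩ : ∃ i, M.get i = n + 1 := by
    have : n + 1 ∈ (M : Multiset ℕ) := by rw [hM]; simp
    exact List.mem_iff_get.1 this
  have hcomm : Commute (Matrix.toLin' A) (Matrix.toLin' B) := by
    rw [commute_iff_eq, Module.End.mul_eq_comp, Module.End.mul_eq_comp, ← Matrix.toLin'_mul,
      ← Matrix.toLin'_mul, hAB.eq]
  obtain ⟨φ, hφ⟩ := hc.exists_isFreePresentation (by omega) hLlen hLget
  have h1 := hc.finrank_le
  have h2 := he.finrank_le
  have h3 := he.le_finrank fun i => by have := hMget i; omega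
  rw [hLlen] at h1
  rw [hMlen] at h2 h3
  refine he.pow_ne_zero (m := n) (i := i) (by omega) (hφ.pow_eq_zero hn hcomm
    ⟨n + 1, he.pow_eq_zero fun i => by have := hMget i; omega⟩ (fun hle => ?_)
    (LinearMap.range_pow_le_range_of_commute hcomm
      ⟨n, hc.pow_eq_zero fun i => (hLget i).le⟩ h2) hU)
  exact (Submodule.eq_of_le_of_finrank_le hle (by omega)).ge

/-- A Jordan basis exists as soon as the ends of the given Jordan chains are independent. -/
theorem exists_isJordanBasis_of_linearIndependent {K V : Type*} [Field K] [AddCommGroup V]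
    [Module K V] [Module.Finite K V] {f : Module.End K V} {L : List ℕ} (u : Fin L.length → V)
    (hpos : ∀ i, 0 < L.get i) (hzero : ∀ i, (f ^ L.get i) (u i) = 0)
    (hli : LinearIndependent K fun i => (f ^ (L.get i - 1)) (u i))
    (hsum : L.sum = Module.finrank K V) :
    ∃ c : Module.Basis ((i : Fin L.length) × Fin (L.get i)) K V, IsJordanBasis f L c := by
  let w : ((i : Fin L.length) × Fin (L.get i)) → V := fun x => (f ^ (L.get x.1 - 1 - x.2)) (u x.1)
  have hcard : Fintype.card ((i : Fin L.length) × Fin (L.get i)) = Module.finrank K V := by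
    simp [← hsum, Fin.sum_univ_getElem]
  have hw : LinearIndependent K w := by
    rw [Fintype.linearIndependent_iff]
    intro a ha
    suffices h : ∀ k i (j : Fin (L.get i)), L.sum ≤ j + k → a ⟨i, j⟩ = 0 from
      fun x => h L.sum x.1 x.2 (Nat.le_add_left _ _)
    intro k
    induction k with
    | zero =>
      intro i j h
      have := j.2.trans_le (List.le_sum_of_mem (List.get_mem L i))
      omega
    | succ k ih =>
      intro i₀ j₀ h₀
      by_cases hk : L.sum ≤ j₀ + k
      · exact ih i₀ j₀ hk
      obtain ⟨m, hm⟩ : ∃ m : ℕ, (j₀ : ℕ) = m := ⟨_, rfl⟩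
      have h1 := congrArg (f ^ m) ha
      rw [map_sum, Fintype.sum_sigma, map_zero] at h1
      have h2 : ∀ i, ∑ j, (f ^ m) (a ⟨i, j⟩ • w ⟨i, j⟩) =
          (if h : m < L.get i then a ⟨i, ⟨m, h⟩⟩ else 0) • (f ^ (L.get i - 1)) (u i) := by
        intro i
        have h3 : ∀ j : Fin (L.get i), (j : ℕ) ≠ m → (f ^ m) (a ⟨i, j⟩ • w ⟨i, j⟩) = 0 := by
          intro j hj
          rcases lt_or_gt_of_ne hj with h | h
          · have : m + (L.get i - 1 - j) = (m - 1 - j) + L.get i := by have := j.2; omega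
            rw [map_smul, ← Module.End.mul_apply, ← pow_add, this, pow_add, Module.End.mul_apply,
              hzero, map_zero, smul_zero]
          · rw [ih i j (by omega), zero_smul, map_zero]
        split_ifs with h
        · rw [Finset.sum_eq_single ⟨m, h⟩ (fun j _ hj => h3 j fun h' => hj (Fin.ext h')) (by simp),
            map_smul, ← Module.End.mul_apply, ← pow_add,
            show m + (L.get i - 1 - m) = L.get i - 1 by omega]
        · rw [zero_smul]
          exact Finset.sum_eq_zero fun j _ => h3 j (by have := j.2; omega)
      simp only [h2] at h1
      have h4 := Fintype.linearIndependent_iff.1 hli _ h1 i₀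
      subst hm
      rwa [dif_pos j₀.2] at h4
  refine ⟨basisOfLinearIndependentOfCardEqFinrank' w hw hcard, fun i j => ?_⟩
  rw [coe_basisOfLinearIndependentOfCardEqFinrank']
  simp only [w]
  rw [← Module.End.mul_apply, ← pow_succ']
  have hj := j.2
  split_ifs with h
  · rw [h, show L.get i - 1 - 0 + 1 = L.get i by have := hpos i; omega, hzero]
  · rw [show L.get i - 1 - j + 1 = L.get i - 1 - (j - 1) by omega]

theorem exists_isJordanBasis_pair {K V : Type*} [Field K] [AddCommGroup V] [Module K V]
    [Module.Finite K V] {f : Module.End K V} {a b : ℕ} (ha : 0 < a) (hb : 0 < b) {u v : V}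
    (hu : (f ^ a) u = 0) (hv : (f ^ b) v = 0)
    (hli : LinearIndependent K ![(f ^ (a - 1)) u, (f ^ (b - 1)) v])
    (hsum : a + b = Module.finrank K V) :
    ∃ c : Module.Basis ((i : Fin [a, b].length) × Fin ([a, b].get i)) K V,
      IsJordanBasis f [a, b] c := by
  refine exists_isJordanBasis_of_linearIndependent (L := [a, b]) (![u, v] : Fin 2 → V) ?_ ?_ ?_
    (by simpa using hsum)
  · exact Fin.forall_fin_two.2 ⟨ha, hb⟩
  · exact Fin.forall_fin_two.2 ⟨hu, hv⟩
  · have h : (fun i : Fin 2 => (f ^ ([a, b].get i - 1)) ((![u, v] : Fin 2 → V) i)) =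
        ![(f ^ (a - 1)) u, (f ^ (b - 1)) v] := funext (Fin.forall_fin_two.2 ⟨rfl, rfl⟩)
    rw [← h] at hli
    exact hli

section LucasEnd

variable {K R : Type*} [CommRing K] [CommRing R] [Algebra K R]

/-- Multiplication by `t` on `R²`. -/
def mulEnd (K : Type*) {R : Type*} [CommRing K] [CommRing R] [Algebra K R] (t : R) :
    Module.End K (R × R) :=
  Algebra.lsmul K K (R × R) t

/-- The companion endomorphism of `x ^ 2 - s t x + d t ^ 2` on `R²`. -/
def lucasEnd (s d : K) (t : R) : Module.End K (R × R) where
  toFun v := (-(d • t ^ 2 * v.2), v.1 + s • t * v.2)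
  map_add' v w := by ext <;> simp [Algebra.smul_def] <;> ring
  map_smul' a v := by ext <;> simp [Algebra.smul_def] <;> ring

theorem commute_mulEnd_lucasEnd (s d : K) (t : R) : Commute (mulEnd K t) (lucasEnd s d t) := by
  ext v <;> simp [mulEnd, lucasEnd, Algebra.smul_def] <;> ring

theorem mulEnd_pow_apply (t : R) (k : ℕ) (v : R × R) :
    (mulEnd K t ^ k) v = (t ^ k * v.1, t ^ k * v.2) := by
  rw [mulEnd, ← map_pow]
  rfl

theorem lucasEnd_pow_succ_apply (s d : K) (t : R) (k : ℕ) :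
    (lucasEnd s d t ^ (k + 1)) (1, 0) =
      (-((d * lucasU s d k) • t ^ (k + 1)), lucasU s d (k + 1) • t ^ k) := by
  induction k with
  | zero => simp [lucasEnd, lucasU]
  | succ k ih =>
    rw [pow_succ', Module.End.mul_apply, ih, lucasU_succ_succ]
    ext
    · simp [lucasEnd, Algebra.smul_def]
      ring
    · simp [lucasEnd, Algebra.smul_def]
      ring

end LucasEnd

theorem exists_isJordanBasis_mulEnd {K R : Type*} [Field K] [CommRing R] [Algebra K R]
    [Module.Finite K R] {t : R} {n : ℕ} (hn : 0 < n) (hrank : Module.finrank K R = n)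
    (ht : t ^ n = 0) (ht' : t ^ (n - 1) ≠ 0) :
    ∃ c : Module.Basis ((i : Fin [n, n].length) × Fin ([n, n].get i)) K (R × R),
      IsJordanBasis (mulEnd K t) [n, n] c := by
  refine exists_isJordanBasis_pair (u := (1, 0)) (v := (0, 1)) hn hn ?_ ?_ ?_ ?_
  · simp [mulEnd_pow_apply, ht]
  · simp [mulEnd_pow_apply, ht]
  · rw [LinearIndependent.pair_iff]
    intro x y h
    simpa [mulEnd_pow_apply, ht'] using h
  · rw [Module.finrank_prod, hrank]

theorem exists_isJordanBasis_lucasEnd {K R : Type*} [Field K] [CommRing R] [Algebra K R]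
    [Module.Finite K R] {t : R} {n : ℕ} (hn : 3 ≤ n) (hrank : Module.finrank K R = n)
    (ht : t ^ n = 0) (ht' : t ^ (n - 1) ≠ 0) {s d : K} (hd : d ≠ 0) (hU : lucasU s d n ≠ 0) :
    ∃ c : Module.Basis ((i : Fin [n + 1, n - 1].length) × Fin ([n + 1, n - 1].get i)) K (R × R),
      IsJordanBasis (lucasEnd s d t) [n + 1, n - 1] c := by
  obtain ⟨k, rfl⟩ : ∃ k, n = k + 3 := ⟨n - 3, by omega⟩
  rw [show k + 3 - 1 = k + 2 by omega] at *
  have htt : t * t ^ (k + 2) = 0 := by rw [← pow_succ', ht]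
  have hw : ∀ m, (lucasEnd s d t ^ m) (lucasU s d (k + 3) • (t, 0) -
      lucasU s d (k + 2) • (lucasEnd s d t) (1, 0)) =
      (lucasU s d (k + 3) • (t * ((lucasEnd s d t ^ m) (1, 0)).1) -
        lucasU s d (k + 2) • ((lucasEnd s d t ^ (m + 1)) (1, 0)).1,
       lucasU s d (k + 3) • (t * ((lucasEnd s d t ^ m) (1, 0)).2) -
        lucasU s d (k + 2) • ((lucasEnd s d t ^ (m + 1)) (1, 0)).2) := by
    intro m
    have h1 : ((t, 0) : R × R) = mulEnd K t (1, 0) := by simp [mulEnd]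
    rw [map_sub, map_smul, map_smul, h1, ← Module.End.mul_apply _ (mulEnd K t),
      ← ((commute_mulEnd_lucasEnd s d t).pow_right m).eq, Module.End.mul_apply,
      ← Module.End.mul_apply _ (lucasEnd s d t), ← pow_succ]
    ext <;> simp [mulEnd]
  refine exists_isJordanBasis_pair (u := (1, 0)) (v := lucasU s d (k + 3) • (t, 0) -
      lucasU s d (k + 2) • (lucasEnd s d t) (1, 0)) (by omega) (by omega) ?_ ?_ ?_ ?_
  · rw [lucasEnd_pow_succ_apply, pow_succ, ht]
    simp
  · rw [hw, lucasEnd_pow_succ_apply, lucasEnd_pow_succ_apply, ht]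
    ext
    · simp [← pow_succ', ht]
    · simp [← pow_succ', smul_smul, mul_comm]
  · rw [LinearIndependent.pair_iff]
    intro x y h
    rw [show k + 3 + 1 - 1 = k + 2 + 1 by omega, show k + 2 - 1 = k + 1 by omega, hw,
      lucasEnd_pow_succ_apply, lucasEnd_pow_succ_apply, lucasEnd_pow_succ_apply] at h
    have h2 := congrArg Prod.snd h
    simp only [Prod.snd_add, Prod.smul_snd, Prod.snd_zero] at h2
    have hy : (y * d ^ (k + 1)) • t ^ (k + 2) = 0 := by
      rw [← lucasU_sq_sub s d (k + 1)]
      have h3 := congrArg (t * ·) h2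
      simp only [Algebra.smul_def, map_mul, map_sub, map_pow] at h3 ⊢
      linear_combination -h3 + algebraMap K R x * algebraMap K R (lucasU s d (k + 3)) * htt
    rw [smul_eq_zero, or_iff_left ht', mul_eq_zero, or_iff_left (pow_ne_zero _ hd)] at hy
    subst hy
    rw [zero_smul, add_zero, smul_smul, smul_eq_zero, or_iff_left ht', mul_eq_zero,
      or_iff_left hU] at h2
    exact ⟨h2, rfl⟩
  · rw [Module.finrank_prod, hrank]
    omega

theorem exists_commute_of_lucasU_ne_zero {K : Type*} [Field K] {n N : ℕ} (hn : 3 ≤ n)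
    (hN : N = n + n) {s d : K} (hd : d ≠ 0) (hU : lucasU s d n ≠ 0) {lam mu : Nat.Partition N}
    (hlam : lam.parts = {n, n}) (hmu : mu.parts = {n + 1, n - 1}) :
    ∃ A B : Matrix (Fin N) (Fin N) K,
      HasJordanPartition A lam ∧ HasJordanPartition B mu ∧ Commute A B := by
  have hX : (X ^ n : K[X]) ≠ 0 := pow_ne_zero _ X_ne_zero
  let pb := AdjoinRoot.powerBasis hX
  have : Module.Finite K (AdjoinRoot (X ^ n : K[X])) := pb.finite
  have hrank : Module.finrank K (AdjoinRoot (X ^ n : K[X])) = n := by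
    rw [pb.finrank, AdjoinRoot.powerBasis_dim, natDegree_X_pow]
  have hmk : ∀ m, AdjoinRoot.root (X ^ n : K[X]) ^ m = 0 ↔ n ≤ m := fun m => by
    rw [← AdjoinRoot.mk_X, ← map_pow, AdjoinRoot.mk_eq_zero,
      pow_dvd_pow_iff X_ne_zero not_isUnit_X]
  have ht := (hmk n).2 le_rfl
  have ht' : AdjoinRoot.root (X ^ n : K[X]) ^ (n - 1) ≠ 0 := by
    rw [Ne, hmk]
    omega
  obtain ⟨c, hc⟩ := exists_isJordanBasis_mulEnd (by omega) hrank ht ht'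
  obtain ⟨e, he⟩ := exists_isJordanBasis_lucasEnd hn hrank ht ht' hd hU
  let b : Module.Basis (Fin N) K (AdjoinRoot (X ^ n : K[X]) × AdjoinRoot (X ^ n : K[X])) :=
    Module.finBasisOfFinrankEq K _ (by rw [Module.finrank_prod, hrank, hN])
  refine ⟨_, _, hc.hasJordanPartition b hlam.symm, he.hasJordanPartition b hmu.symm, ?_⟩
  rw [commute_iff_eq, ← LinearMap.toMatrix_mul, ← LinearMap.toMatrix_mul,
    (commute_mulEnd_lucasEnd s d _).eq]

/-- For every prime `p` and every `r ≥ 1` there are partitions `λ` and `μ` of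
some common integer `n` such that the nilpotent similarity classes `N(λ)` and
`N(μ)` commute over the field `F_{p^a}` if and only if `a > r`. -/
theorem stmt18 (p r : ℕ) (hp : p.Prime) (hr : 1 ≤ r) :
    ∃ (n : ℕ) (lam mu : Nat.Partition n),
      ∀ (a : ℕ) (K : Type) [Field K] [Fintype K], Fintype.card K = p ^ a →
        ((∃ X Y : Matrix (Fin n) (Fin n) K,
            HasJordanPartition X lam ∧ HasJordanPartition Y mu ∧ Commute X Y) ↔
          r < a) := by
  have hn := three_le_lcmExponent hp hr
  refine ⟨lcmExponent p r + lcmExponent p r,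
    ⟨{lcmExponent p r, lcmExponent p r}, by simp; omega, by simp⟩,
    ⟨{lcmExponent p r + 1, lcmExponent p r - 1}, by simp; omega, by simp; omega⟩, ?_⟩
  intro a K _ _ hK
  constructor
  · rintro ⟨A, B, hA, hB, hAB⟩
    by_contra! har
    have ha : a ≠ 0 := by
      rintro rfl
      exact Fintype.one_lt_card.ne' (hK.trans (pow_zero p))
    have hp0 : (p : K) = 0 := by
      have h := FiniteField.cast_card_eq_zero K
      rw [hK, Nat.cast_pow] at h
      exact eq_zero_of_pow_eq_zero h
    have hdvd : p ∣ lcmExponent p r := Dvd.intro _ rfl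
    refine not_commute_of_lucasU_eq_zero hn
      (fun s d hd => lucasU_eq_zero_of_dvd (by omega) ?_ ?_ s hd)
      rfl rfl hA hB hAB
    · obtain ⟨m, hm⟩ := hdvd
      rw [hm, Nat.cast_mul, hp0, zero_mul]
    · rw [hK, ← pow_mul, mul_comm a]
      exact pow_two_mul_sub_one_dvd_lcmExponent (Nat.pos_of_ne_zero ha) har
  · intro har
    obtain ⟨s, d, hd, hU⟩ := exists_lucasU_ne_zero (K := K) (n := lcmExponent p r)
      (by rw [hK]; exact not_dvd_lcmExponent hp har)
    exact exists_commute_of_lucasU_ne_zero hn rfl hd hU rfl rfl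
end

section
/- Let λ = (a,b) and μ = (c,d) be partitions with a + b = c + d and a > c ≥ d > b. If the nilpotent similarity classes N(λ) and N(μ) commute over some field K, then c = d and a − b = 2. -/
open Polynomial Matrix

/-- Coordinates on `V` in which `x` acts as the direct sum of two nilpotent Jordan blocks
of sizes `p` and `q`; the two coordinate sequences are extended by zero to all of `ℕ`. -/
structure JordanCoords {K V : Type*} [Field K] [AddCommGroup V] [Module K V]
    (x : Module.End K V) (p q : ℕ) where
  fst : V →ₗ[K] ℕ → K
  snd : V →ₗ[K] ℕ → K
  fst_map : ∀ v i, fst (x v) i = fst v (i + 1)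
  snd_map : ∀ v i, snd (x v) i = snd v (i + 1)
  fst_eq_zero : ∀ v i, p ≤ i → fst v i = 0
  snd_eq_zero : ∀ v i, q ≤ i → snd v i = 0
  eq_zero : ∀ v, fst v = 0 → snd v = 0 → v = 0
  exists_eq : ∀ f g : ℕ → K, (∀ i, p ≤ i → f i = 0) → (∀ i, q ≤ i → g i = 0) →
    ∃ v, fst v = f ∧ snd v = g

namespace JordanCoords

variable {K V : Type*} [Field K] [AddCommGroup V] [Module K V] {x : Module.End K V} {p q : ℕ}

/-- Exchange the two blocks. -/
def swap (J : JordanCoords x p q) : JordanCoords x q p where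
  fst := J.snd
  snd := J.fst
  fst_map := J.snd_map
  snd_map := J.fst_map
  fst_eq_zero := J.snd_eq_zero
  snd_eq_zero := J.fst_eq_zero
  eq_zero v h h' := J.eq_zero v h' h
  exists_eq f g hf hg := (J.exists_eq g f hg hf).imp fun _ h => h.symm

lemma fst_pow (J : JordanCoords x p q) (k : ℕ) (v : V) (i : ℕ) :
    J.fst ((x ^ k) v) i = J.fst v (i + k) := by
  induction k generalizing i with
  | zero => simp
  | succ k ih =>
    rw [pow_succ', Module.End.mul_apply, J.fst_map, ih, add_right_comm, add_assoc]

lemma snd_pow (J : JordanCoords x p q) (k : ℕ) (v : V) (i : ℕ) :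
    J.snd ((x ^ k) v) i = J.snd v (i + k) :=
  J.swap.fst_pow k v i

lemma pow_eq_zero (J : JordanCoords x p q) {k : ℕ} (hp : p ≤ k) (hq : q ≤ k) : x ^ k = 0 := by
  ext v
  apply J.eq_zero
  · ext i
    rw [J.fst_pow, J.fst_eq_zero _ _ (by omega)]
    rfl
  · ext i
    rw [J.snd_pow, J.snd_eq_zero _ _ (by omega)]
    rfl

lemma exists_generators (J : JordanCoords x p q) (hp : 0 < p) (hq : 0 < q) :
    ∃ e₁ e₂ : V, J.fst e₁ = Pi.single (p - 1) 1 ∧ J.snd e₁ = 0 ∧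
      J.fst e₂ = 0 ∧ J.snd e₂ = Pi.single (q - 1) 1 ∧
      ∀ v, ∃ w, v = J.fst v (p - 1) • e₁ + J.snd v (q - 1) • e₂ + x w := by
  obtain ⟨e₁, h₁, h₁'⟩ := J.exists_eq (Pi.single (p - 1) 1) 0
    (fun i hi => Pi.single_eq_of_ne (by omega) _) (fun _ _ => rfl)
  obtain ⟨e₂, h₂, h₂'⟩ := J.exists_eq 0 (Pi.single (q - 1) 1)
    (fun _ _ => rfl) (fun i hi => Pi.single_eq_of_ne (by omega) _)
  refine ⟨e₁, e₂, h₁, h₁', h₂, h₂', fun v => ?_⟩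
  obtain ⟨w, hw, hw'⟩ := J.exists_eq
    (fun i => if i = 0 ∨ p ≤ i then 0 else J.fst v (i - 1))
    (fun i => if i = 0 ∨ q ≤ i then 0 else J.snd v (i - 1))
    (fun i hi => by simp [hi]) (fun i hi => by simp [hi])
  refine ⟨w, sub_eq_zero.mp (J.eq_zero _ ?_ ?_)⟩
  · ext i
    simp only [map_sub, map_add, map_smul, h₁, h₂, Pi.sub_apply, Pi.add_apply, Pi.smul_apply,
      J.fst_map, hw, Pi.zero_apply, smul_eq_mul, mul_zero, add_zero, Pi.single_apply]
    rcases lt_trichotomy i (p - 1) with h | rfl | h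
    · rw [if_neg (by omega), if_neg (by omega)]; simp
    · rw [if_pos rfl, if_pos (by omega)]; simp
    · rw [if_neg (by omega), if_pos (by omega), J.fst_eq_zero _ _ (by omega)]; simp
  · ext i
    simp only [map_sub, map_add, map_smul, h₁', h₂', Pi.sub_apply, Pi.add_apply, Pi.smul_apply,
      J.snd_map, hw', Pi.zero_apply, smul_eq_mul, mul_zero, zero_add, Pi.single_apply]
    rcases lt_trichotomy i (q - 1) with h | rfl | h
    · rw [if_neg (by omega), if_neg (by omega)]; simp
    · rw [if_pos rfl, if_pos (by omega)]; simp
    · rw [if_neg (by omega), if_pos (by omega), J.snd_eq_zero _ _ (by omega)]; simp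

/-- If `x` has Jordan type `(a, b)` with `a ≥ b + 3` and `y` commutes with `x`, satisfies
`y ^ (a - 1) = 0`, and has corank at most `2`, then `b = 0`. -/
lemma false_of_commute {a b : ℕ} {y : Module.End K V} (J : JordanCoords x a b)
    (hb : 0 < b) (hab : b + 3 ≤ a) (hxy : Commute x y) (hy : y ^ (a - 1) = 0)
    (g₁ g₂ : V) (hg : ∀ v, ∃ r s : K, ∃ w, v = r • g₁ + s • g₂ + y w) : False := by
  obtain ⟨e₁, e₂, h₁, h₁', h₂, h₂', hdec⟩ := J.exists_generators (by omega) hb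
  have hc : ∀ v, y (x v) = x (y v) := fun v => (LinearMap.congr_fun hxy.eq v).symm
  have hcp : ∀ k v, (x ^ k) (y v) = y ((x ^ k) v) :=
    fun k v => LinearMap.congr_fun (hxy.pow_left k).eq v
  let α : V →ₗ[K] K := LinearMap.proj (a - 1) ∘ₗ J.fst
  let α' : V →ₗ[K] K := LinearMap.proj (a - 2) ∘ₗ J.fst
  let α'' : V →ₗ[K] K := LinearMap.proj (a - 3) ∘ₗ J.fst
  let β : V →ₗ[K] K := LinearMap.proj (b - 1) ∘ₗ J.snd
  have hdec : ∀ v, ∃ w, v = α v • e₁ + β v • e₂ + x w := hdec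
  have αx : ∀ v, α (x v) = 0 := fun v =>
    (J.fst_map v _).trans (J.fst_eq_zero _ _ (by omega))
  have βx : ∀ v, β (x v) = 0 := fun v =>
    (J.snd_map v _).trans (J.snd_eq_zero _ _ (by omega))
  have αx' : ∀ v, α' (x v) = α v := fun v =>
    (J.fst_map v _).trans (congrArg (J.fst v) (by omega))
  have αx'' : ∀ v, α'' (x v) = α' v := fun v =>
    (J.fst_map v _).trans (congrArg (J.fst v) (by omega))
  have α1 : α e₁ = 1 := by simp [α, h₁]
  have α1' : α' e₁ = 0 := by
    simp only [α', LinearMap.comp_apply, LinearMap.proj_apply, h₁]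
    exact Pi.single_eq_of_ne (by omega) _
  have α1'' : α'' e₁ = 0 := by
    simp only [α'', LinearMap.comp_apply, LinearMap.proj_apply, h₁]
    exact Pi.single_eq_of_ne (by omega) _
  have β1 : β e₁ = 0 := by simp [β, h₁']
  have α2 : α e₂ = 0 := by simp [α, h₂]
  have α2' : α' e₂ = 0 := by simp [α', h₂]
  have α2'' : α'' e₂ = 0 := by simp [α'', h₂]
  have β2 : β e₂ = 1 := by simp [β, h₂']
  have xe₂ : ∀ k, b ≤ k → (x ^ k) e₂ = 0 := fun k hk => J.eq_zero _
    (by ext i; rw [J.fst_pow, h₂]; rfl)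
    (by ext i; rw [J.snd_pow, J.snd_eq_zero _ _ (by omega)]; rfl)
  have xpow : ∀ k, a ≤ k → ∀ v, (x ^ k) v = 0 := fun k hk v => by
    rw [J.pow_eq_zero hk (by omega)]; rfl
  have xe₁ : (x ^ (a - 1)) e₁ ≠ 0 := fun h => by
    have := J.fst_pow (a - 1) e₁ 0
    rw [h, h₁] at this
    simp at this
  have pow_x : ∀ k v, (x ^ k) (x v) = (x ^ (k + 1)) v := fun k v => by
    rw [pow_succ, Module.End.mul_apply]
  have x_pow : ∀ k v, x ((x ^ k) v) = (x ^ (k + 1)) v := fun k v => by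
    rw [pow_succ', Module.End.mul_apply]
  -- the top coefficient is detected by `x ^ (a - 1)`
  have α_of : ∀ v, (x ^ (a - 1)) v = 0 → α v = 0 := fun v hv => by
    obtain ⟨w, hw⟩ := hdec v
    rw [hw, map_add, map_add, map_smul, map_smul, pow_x,
      xe₂ (a - 1) (by omega), xpow (a - 1 + 1) (by omega)] at hv
    simpa [xe₁] using hv
  have αy2 : α (y e₂) = 0 := α_of _ (by rw [hcp, xe₂ _ (by omega), map_zero])
  have αy : ∀ v, α (y v) = α (y e₁) * α v := fun v => by
    obtain ⟨w, hw⟩ := hdec v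
    conv_lhs => rw [hw]
    simp [hc, αx, αy2, mul_comm]
  have f0 : α (y e₁) = 0 := by
    have : ∀ m, α ((y ^ m) e₁) = α (y e₁) ^ m := fun m => by
      induction m with
      | zero => simp [α1]
      | succ m ih => rw [pow_succ', Module.End.mul_apply, αy, ih, pow_succ']
    have h := this (a - 1)
    rw [hy, LinearMap.zero_apply, map_zero] at h
    exact eq_zero_of_pow_eq_zero h.symm
  have αy0 : ∀ v, α (y v) = 0 := fun v => by rw [αy, f0, zero_mul]
  have βy : ∀ v, β (y v) = α v * β (y e₁) + β v * β (y e₂) := fun v => by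
    obtain ⟨w, hw⟩ := hdec v
    conv_lhs => rw [hw]
    simp [hc, βx]
  have k0 : β (y e₂) = 0 := by
    have : ∀ m, α ((y ^ m) e₂) = 0 ∧ β ((y ^ m) e₂) = β (y e₂) ^ m := fun m => by
      induction m with
      | zero => simp [α2, β2]
      | succ m ih =>
        rw [pow_succ', Module.End.mul_apply, αy0, βy, ih.1, ih.2, pow_succ]
        simp
    have h := (this (a - 1)).2
    rw [hy, LinearMap.zero_apply, map_zero] at h
    exact eq_zero_of_pow_eq_zero h.symm
  -- `y e₂ = x w₀` with `w₀` in the common kernel of `α` and `α'`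
  obtain ⟨w₀, hw₀, αw₀, αw₀'⟩ : ∃ w₀, y e₂ = x w₀ ∧ α w₀ = 0 ∧ α' w₀ = 0 := by
    obtain ⟨w, hw⟩ := hdec (y e₂)
    rw [αy2, k0, zero_smul, zero_smul, zero_add, zero_add] at hw
    have hw2 : (x ^ (a - 3)) (x w) = 0 := by rw [← hw, hcp, xe₂ _ (by omega), map_zero]
    have hαw : α w = 0 := α_of _ (by
      have := congrArg x hw2
      rwa [pow_x, x_pow, map_zero, show a - 3 + 1 + 1 = a - 1 by omega] at this)
    refine ⟨w, hw, hαw, ?_⟩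
    obtain ⟨w', hw'⟩ := hdec w
    rw [hαw, zero_smul, zero_add] at hw'
    rw [hw', map_add, map_smul, α2', smul_zero, zero_add, αx']
    apply α_of
    rw [pow_x, hw', map_add, pow_x, map_smul, xe₂ _ (by omega), smul_zero, zero_add] at hw2
    rwa [show a - 3 + 1 + 1 = a - 1 by omega] at hw2
  have ker_dec : ∀ u, α u = 0 → α' u = 0 →
      ∃ r s : K, ∃ w, u = r • e₂ + s • x e₂ + x (x w) := fun u hu hu' => by
    obtain ⟨w, hw⟩ := hdec u
    obtain ⟨w', hw'⟩ := hdec w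
    have : α w = 0 := by
      rw [hw] at hu'
      simpa [α1', α2', αx', hu] using hu'
    rw [this, zero_smul, zero_add] at hw'
    rw [hu, zero_smul, zero_add] at hw
    refine ⟨β u, β w, w', ?_⟩
    conv_lhs => rw [hw, hw']
    rw [map_add, map_smul, add_assoc]
  have y_ker : ∀ u, α u = 0 → α' u = 0 → ∃ u', y u = x u' ∧ α u' = 0 ∧ α' u' = 0 :=
    fun u hu hu' => by
      obtain ⟨r, s, w, rfl⟩ := ker_dec u hu hu'
      refine ⟨r • w₀ + s • x w₀ + x (y w), ?_, ?_, ?_⟩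
      · simp [hc, hw₀]
      · simp [αw₀, αx]
      · simp [αw₀, αw₀', αx', αy0]
  have key : ∀ m, ∃ u, α u = 0 ∧ α' u = 0 ∧
      (y ^ (m + 1)) e₁ = α' (y e₁) ^ (m + 1) • (x ^ (m + 1)) e₁ + (x ^ m) u := fun m => by
    have hu₀ : α (y e₁ - α' (y e₁) • x e₁) = 0 := by simp [αy0, αx]
    have hu₀' : α' (y e₁ - α' (y e₁) • x e₁) = 0 := by simp [αx', α1]
    induction m with
    | zero => exact ⟨_, hu₀, hu₀', by simp⟩
    | succ m ih =>
      obtain ⟨u, hu, hu', h⟩ := ih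
      obtain ⟨u₁, h₁, hu₁, hu₁'⟩ := y_ker u hu hu'
      refine ⟨α' (y e₁) ^ (m + 1) • (y e₁ - α' (y e₁) • x e₁) + u₁, ?_, ?_, ?_⟩
      · rw [map_add, map_smul, hu₀, hu₁, smul_zero, add_zero]
      · rw [map_add, map_smul, hu₀', hu₁', smul_zero, add_zero]
      · rw [pow_succ', Module.End.mul_apply, h, map_add, map_smul, ← hcp, ← hcp, h₁, pow_x,
          map_add, map_smul, map_sub, map_smul, pow_x, smul_sub, smul_smul, ← pow_succ]
        abel
  have f1 : α' (y e₁) = 0 := by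
    obtain ⟨u, hu, hu', h⟩ := key (a - 2)
    obtain ⟨r, s, w, rfl⟩ := ker_dec u hu hu'
    rw [show a - 2 + 1 = a - 1 by omega, hy, map_add, map_add, map_smul, map_smul, pow_x, pow_x,
      pow_x, xe₂ (a - 2) (by omega), xe₂ (a - 2 + 1) (by omega),
      xpow (a - 2 + 1 + 1) (by omega)] at h
    simpa [xe₁, show a - 1 ≠ 0 by omega] using h.symm
  have αy' : ∀ v, α' (y v) = 0 := fun v => by
    obtain ⟨w, hw⟩ := hdec v
    rw [hw]
    simp [hc, f1, hw₀, αx', αw₀, αy0]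
  have αy'' : ∀ v, α'' (y v) = α v * α'' (y e₁) := fun v => by
    obtain ⟨w, hw⟩ := hdec v
    conv_lhs => rw [hw]
    simp [hc, hw₀, αx'', αw₀', αy']
  let T : V →ₗ[K] Fin 4 → K := LinearMap.pi ![α, α', α'', β]
  have hT : ∀ v, T v = ![α v, α' v, α'' v, β v] := fun v => by
    ext i
    fin_cases i <;> rfl
  have hspan : Submodule.span K (Set.range ![T (y e₁), T g₁, T g₂]) = ⊤ := by
    refine eq_top_iff.mpr fun t _ => ?_
    have ht : t = T (t 0 • e₁ + t 1 • x e₁ + t 2 • x (x e₁) + t 3 • e₂) := by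
      rw [hT]
      ext i
      fin_cases i <;>
        simp [αx, αx', αx'', βx, α1, α1', α1'', β1, α2, α2', α2'', β2]
    obtain ⟨r, s, w, hw⟩ := hg (t 0 • e₁ + t 1 • x e₁ + t 2 • x (x e₁) + t 3 • e₂)
    have hTy : T (y w) = α w • T (y e₁) := by
      rw [hT, hT, αy0, αy0, αy', αy', αy'', βy, k0]
      ext i
      fin_cases i <;> simp
    rw [ht, hw, map_add, map_add, map_smul, map_smul, hTy]
    have mem : ∀ i, ![T (y e₁), T g₁, T g₂] i ∈
        Submodule.span K (Set.range ![T (y e₁), T g₁, T g₂]) :=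
      fun i => Submodule.subset_span ⟨i, rfl⟩
    exact add_mem (add_mem (Submodule.smul_mem _ _ (mem 1)) (Submodule.smul_mem _ _ (mem 2)))
      (Submodule.smul_mem _ _ (mem 0))
  have := finrank_range_le_card (R := K) ![T (y e₁), T g₁, T g₂]
  rw [Set.finrank, hspan, finrank_top, Module.finrank_fin_fun, Fintype.card_fin] at this
  omega

end JordanCoords

lemma blockDiagonal'_jordanBlock_mulVec {K : Type*} [Field K] {ι : Type*} [Fintype ι]
    [DecidableEq ι] (l : ι → ℕ) (v : ((k : ι) × Fin (l k)) → K) (k : ι) (i : Fin (l k)) :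
    (Matrix.blockDiagonal' (fun k => jordanBlock K (l k)) *ᵥ v) ⟨k, i⟩ =
      if h : (i : ℕ) + 1 < l k then v ⟨k, ⟨i + 1, h⟩⟩ else 0 := by
  rw [Matrix.mulVec, dotProduct, Fintype.sum_sigma, Finset.sum_eq_single k]
  · simp only [Matrix.blockDiagonal'_apply_eq, jordanBlock, Matrix.of_apply, ite_mul, one_mul,
      zero_mul]
    split_ifs with h
    · rw [Finset.sum_eq_single ⟨i + 1, h⟩]
      · simp
      · intro j _ hj
        exact if_neg fun h' => hj (Fin.ext h'.symm)
      · simp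
    · exact Finset.sum_eq_zero fun j _ => if_neg (by omega)
  · intro k' _ hk
    exact Finset.sum_eq_zero fun j _ => by
      rw [Matrix.blockDiagonal'_apply_ne _ _ _ hk.symm, zero_mul]
  · simp

lemma nonempty_jordanCoords_of_similar {K : Type*} [Field K] {n p q : ℕ}
    {M : Matrix (Fin n) (Fin n) K}
    (e : ((i : Fin [p, q].length) × Fin ([p, q].get i)) ≃ Fin n)
    (h : SimilarMat
      (Matrix.reindex e e (Matrix.blockDiagonal' fun i => jordanBlock K ([p, q].get i))) M) :
    Nonempty (JordanCoords (Matrix.toLin' M) p q) := by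
  obtain ⟨P, rfl⟩ := h
  set B := Matrix.blockDiagonal' fun i => jordanBlock K ([p, q].get i) with hB
  set M : Matrix (Fin n) (Fin n) K :=
    (P : Matrix (Fin n) (Fin n) K) * Matrix.reindex e e B * (↑P⁻¹ : Matrix (Fin n) (Fin n) K)
    with hM
  let Φ : (Fin n → K) ≃ₗ[K] (((i : Fin [p, q].length) × Fin ([p, q].get i)) → K) :=
    (Matrix.toLin'OfInv P.mul_inv P.inv_mul).trans (LinearEquiv.funCongrLeft K K e)
  have hΦ : ∀ v, Φ (Matrix.toLin' M v) = B *ᵥ Φ v := by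
    intro v
    change ((↑P⁻¹ : Matrix (Fin n) (Fin n) K) *ᵥ (M *ᵥ v)) ∘ e
      = B *ᵥ (((↑P⁻¹ : Matrix (Fin n) (Fin n) K) *ᵥ v) ∘ e)
    rw [Matrix.mulVec_mulVec, hM, ← mul_assoc, ← mul_assoc, Units.inv_mul, one_mul,
      ← Matrix.mulVec_mulVec, Matrix.reindex_apply, Matrix.submatrix_mulVec_equiv]
    ext i
    simp
  have hΦ' : ∀ v k i, Φ (Matrix.toLin' M v) ⟨k, i⟩ =
      if h : (i : ℕ) + 1 < [p, q].get k then Φ v ⟨k, ⟨i + 1, h⟩⟩ else 0 := fun v k i => by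
    rw [hΦ, hB, blockDiagonal'_jordanBlock_mulVec]
  let C (k : Fin [p, q].length) : (Fin n → K) →ₗ[K] ℕ → K :=
    { toFun := fun v i => if h : i < [p, q].get k then Φ v ⟨k, ⟨i, h⟩⟩ else 0
      map_add' := fun v w => by
        ext i
        by_cases h : i < [p, q].get k <;> simp only [h, dite_true, dite_false, map_add,
          Pi.add_apply, add_zero]
      map_smul' := fun r v => by
        ext i
        by_cases h : i < [p, q].get k <;> simp only [h, dite_true, dite_false, map_smul,
          Pi.smul_apply, smul_zero, RingHom.id_apply] }
  have hC : ∀ k v i, C k v i = if h : i < [p, q].get k then Φ v ⟨k, ⟨i, h⟩⟩ else 0 :=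
    fun _ _ _ => rfl
  have C_map : ∀ k v i, C k (Matrix.toLin' M v) i =
      C k v (i + 1) := fun k v i => by
    rw [hC, hC]
    by_cases h : i < [p, q].get k
    · rw [dif_pos h, hΦ']
    · rw [dif_neg h, dif_neg (by omega)]
  have C_zero : ∀ k v i, [p, q].get k ≤ i → C k v i = 0 := fun k v i hi => by
    rw [hC, dif_neg (by omega)]
  have C_apply : ∀ k v (i : Fin ([p, q].get k)), C k v i = Φ v ⟨k, i⟩ := fun k v i => by
    rw [hC, dif_pos i.2]
  refine ⟨⟨C ⟨0, by simp⟩, C ⟨1, by simp⟩, C_map _, C_map _, C_zero ⟨0, by simp⟩,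
    C_zero ⟨1, by simp⟩, ?_, ?_⟩⟩
  · intro v h₀ h₁
    rw [← Φ.map_eq_zero_iff]
    ext ⟨k, i⟩
    rw [← C_apply]
    match k, i with
    | ⟨0, _⟩, i => exact congrFun h₀ i
    | ⟨1, _⟩, i => exact congrFun h₁ i
  · intro f g hf hg
    refine ⟨Φ.symm fun s => if (s.1 : ℕ) = 0 then f s.2 else g s.2, ?_, ?_⟩
    · ext i
      rw [hC]
      split_ifs with h
      · simp
      · exact (hf i (not_lt.mp h)).symm
    · ext i
      rw [hC]
      split_ifs with h
      · simp
      · exact (hg i (not_lt.mp h)).symm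

lemma HasJordanPartition.nonempty_jordanCoords {K : Type*} [Field K] {n p q : ℕ}
    {M : Matrix (Fin n) (Fin n) K} {mu : Nat.Partition n} (h : HasJordanPartition M mu)
    (hmu : mu.parts = {p, q}) : Nonempty (JordanCoords (Matrix.toLin' M) p q) := by
  obtain ⟨L, hL, e, hsim⟩ := h
  have hperm : L.Perm [p, q] := Multiset.coe_eq_coe.mp (hL.trans hmu)
  rcases List.perm_pair.mp hperm with rfl | rfl
  · exact nonempty_jordanCoords_of_similar e hsim
  · exact (nonempty_jordanCoords_of_similar e hsim).map JordanCoords.swap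

/-- Let `λ = (a,b)` and `μ = (c,d)` be partitions with `a + b = c + d` and
`a > c ≥ d > b`.  If the nilpotent similarity classes `N(λ)` and `N(μ)`
commute over some field `K`, then `c = d` and `a - b = 2`. -/
theorem stmt19 {K : Type*} [Field K] (a b c d : ℕ)
    (hba : b ≤ a) (hdc : d ≤ c) (hsum : a + b = c + d)
    (hca : c < a) (hbd : b < d)
    (lam mu : Nat.Partition (a + b))
    (hlam : lam.parts = {a, b}) (hmu : mu.parts = {c, d})
    (hcomm : ∃ X Y : Matrix (Fin (a + b)) (Fin (a + b)) K,
        HasJordanPartition X lam ∧ HasJordanPartition Y mu ∧ Commute X Y) :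
    c = d ∧ a - b = 2 := by
  obtain ⟨X, Y, hX, hY, hXY⟩ := hcomm
  by_contra hne
  have hb : 0 < b := lam.parts_pos (by simp [hlam])
  obtain ⟨J⟩ := hX.nonempty_jordanCoords hlam
  obtain ⟨J'⟩ := hY.nonempty_jordanCoords hmu
  obtain ⟨g₁, g₂, -, -, -, -, hg⟩ := J'.exists_generators (by omega) (by omega)
  refine J.false_of_commute hb (by omega) (y := Matrix.toLin' Y) ?_
    (J'.pow_eq_zero (by omega) (by omega)) g₁ g₂ fun v => ⟨_, _, hg v⟩
  rw [commute_iff_eq, Module.End.mul_eq_comp, Module.End.mul_eq_comp, ← Matrix.toLin'_mul,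
    ← Matrix.toLin'_mul, hXY.eq]
end
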